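/- arXiv:1707.01369 — 2 statements merged into one kernel-verified Lean document; each statement's English description precedes it below -/
import Mathlib

section
/- For disjunctive systems, both |B|_G + k + 1 and |G| + k + 1 are cutoffs for the class of k-indexed LTL\X properties under non-fair (unrestricted) executions, where G = G_A ∪ G_B is the set of non-trivial guards of the templates and |B|_G is the number of states of B that occur in some guard in G. -/
namespace GP

/-- A process template: an initial state and a guarded transition relation.
`Gd` is the type of guards. -/
structure Template (Q Sig Gd : Type) where
  init : Q
  trans : Set (Q × Sig × Gd × Q)

variable {QA QB SA SB Gd : Type}

/-- Processes of `(A,B)^{(1,n)}`: `none` is the `A`-process, `some i` is `B_i`. -/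
abbrev Proc (n : ℕ) := Option (Fin n)
/-- A global state. -/
abbrev GState (QA QB : Type) (n : ℕ) := QA × (Fin n → QB)
/-- A global input. -/
abbrev GInput (SA SB : Type) (n : ℕ) := SA × (Fin n → SB)

/-- The local state of process `p` in global state `s`. -/
def view {n : ℕ} (s : GState QA QB n) : Proc n → QA ⊕ QB
  | none => Sum.inl s.1
  | some i => Sum.inr (s.2 i)

/-- The local input of process `p` in global input `e`. -/
def inp {n : ℕ} (e : GInput SA SB n) : Proc n → SA ⊕ SB
  | none => Sum.inl e.1
  | some i => Sum.inr (e.2 i)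

/-- The set of local states of the processes other than `p`. -/
def others {n : ℕ} (s : GState QA QB n) (p : Proc n) : Set (QA ⊕ QB) :=
  {x | ∃ p', p' ≠ p ∧ view s p' = x}

/-- Disjunctive interpretation of guards: some other process is in the guard. -/
def disjSat (S : Set (QA ⊕ QB)) (g : Set (QA ⊕ QB)) : Prop := ∃ x ∈ S, x ∈ g
/-- Conjunctive interpretation of guards: every other process is in the guard. -/
def conjSat (S : Set (QA ⊕ QB)) (g : Set (QA ⊕ QB)) : Prop := ∀ x ∈ S, x ∈ g
/-- Conjunction-of-disjunctive-guards interpretation: a guard is a finite set of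
disjunctive conjuncts, each of which must be witnessed by some other process. -/
def cdSat (S : Set (QA ⊕ QB)) (g : Set (Set (QA ⊕ QB))) : Prop := ∀ D ∈ g, ∃ x ∈ S, x ∈ D

section System

variable (A : Template QA SA Gd) (B : Template QB SB Gd)
variable (sat : Set (QA ⊕ QB) → Gd → Prop)

/-- Process `p` is enabled for global state `s` and input `e`. -/
def enabled {n : ℕ} (s : GState QA QB n) (e : GInput SA SB n) : Proc n → Prop
  | none => ∃ g q', (s.1, e.1, g, q') ∈ A.trans ∧ sat (others s none) g
  | some i => ∃ g q', (s.2 i, e.2 i, g, q') ∈ B.trans ∧ sat (others s (some i)) g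

/-- One interleaving step of the system, performed by process `p`. -/
def step {n : ℕ} (s : GState QA QB n) (e : GInput SA SB n) : Proc n → GState QA QB n → Prop
  | none, s' => ∃ g q', (s.1, e.1, g, q') ∈ A.trans ∧ sat (others s none) g ∧ s' = (q', s.2)
  | some i, s' => ∃ g q', (s.2 i, e.2 i, g, q') ∈ B.trans ∧ sat (others s (some i)) g ∧
      s' = (s.1, Function.update s.2 i q')

/-- The global initial state. -/
def isInit {n : ℕ} (s : GState QA QB n) : Prop := s.1 = A.init ∧ ∀ i, s.2 i = B.init

/-- An infinite run of `(A,B)^{(1,n)}`: at each moment `t` process `mv t` makes a step,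
and the input of a process stays unchanged until that process moves. -/
structure Run (n : ℕ) where
  s : ℕ → GState QA QB n
  e : ℕ → GInput SA SB n
  mv : ℕ → Proc n
  isInit0 : isInit A B (s 0)
  steps : ∀ t, step A B sat (s t) (e t) (mv t) (s (t + 1))
  persist : ∀ t p, p ≠ mv t → inp (e (t + 1)) p = inp (e t) p

/-- The run `x` is locally deadlocked for process `p`. -/
def lockedFrom {n : ℕ} (x : Run A B sat n) (p : Proc n) : Prop :=
  ∃ t0, ∀ t ≥ t0, ¬ enabled A B sat (x.s t) (x.e t) p

/-- The run `x` is locally deadlocked for the `B`-process `i`, which is stuck in state `q`. -/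
def lockedInState {n : ℕ} (x : Run A B sat n) (i : Fin n) (q : QB) : Prop :=
  ∃ t0, ∀ t ≥ t0, ¬ enabled A B sat (x.s t) (x.e t) (some i) ∧ (x.s t).2 i = q

/-- `(A,B)^{(1,n)}` has a local deadlock. -/
def hasLocalDeadlock (n : ℕ) : Prop :=
  ∃ x : Run A B sat n, ∃ p, lockedFrom A B sat x p

/-- `(A,B)^{(1,n)}` has a global deadlock: a finite maximal path (a finite run) ending
in a configuration where no process is enabled. -/
def hasGlobalDeadlock (n : ℕ) : Prop :=
  ∃ (m : ℕ) (s : ℕ → GState QA QB n) (e : ℕ → GInput SA SB n) (mv : ℕ → Proc n),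
    isInit A B (s 0) ∧
    (∀ t < m, step A B sat (s t) (e t) (mv t) (s (t + 1))) ∧
    (∀ t < m, ∀ p, p ≠ mv t → inp (e (t + 1)) p = inp (e t) p) ∧
    ∀ p, ¬ enabled A B sat (s m) (e m) p

/-- Unconditional fairness: every process moves infinitely often. -/
def uncondFair {n : ℕ} (x : Run A B sat n) : Prop :=
  ∀ p, ∀ t, ∃ t' ≥ t, x.mv t' = p

/-- Strong fairness: every process enabled infinitely often moves infinitely often. -/
def strongFair {n : ℕ} (x : Run A B sat n) : Prop :=
  ∀ p, (∀ t, ∃ t' ≥ t, enabled A B sat (x.s t') (x.e t') p) → (∀ t, ∃ t' ≥ t, x.mv t' = p)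

/-- Initializing run: every process that moves infinitely often visits its
initial state infinitely often. -/
def initializing {n : ℕ} (x : Run A B sat n) : Prop :=
  ∀ p, (∀ t, ∃ t' ≥ t, x.mv t' = p) →
    ∀ t, ∃ t' ≥ t, view (x.s t') p = (match p with
      | none => Sum.inl A.init
      | some _ => Sum.inr B.init)

end System

/-- LTL without the next-time operator (`LTL\X`). -/
inductive LTL (P : Type) : Type
  | atom : P → LTL P
  | tru : LTL P
  | not : LTL P → LTL P
  | and : LTL P → LTL P → LTL P
  | untl : LTL P → LTL P → LTL P

/-- Semantics of `LTL\X` over a trace `w` of valuations. -/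
def LTL.holds {P : Type} (w : ℕ → P → Prop) : LTL P → ℕ → Prop
  | .atom a, t => w t a
  | .tru, _ => True
  | .not f, t => ¬ LTL.holds w f t
  | .and f g, t => LTL.holds w f t ∧ LTL.holds w g t
  | .untl f g, t => ∃ t', t ≤ t' ∧ LTL.holds w g t' ∧ ∀ u, t ≤ u → u < t' → LTL.holds w f u

/-- Atomic propositions of a `k`-indexed formula `h(A, B_{i_1}, …, B_{i_k})`:
states/inputs of `A` and indexed states/inputs of `k` `B`-processes. -/
abbrev AtomK (QA SA QB SB : Type) (k : ℕ) := (QA ⊕ SA) ⊕ ((QB ⊕ SB) × Fin k)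

section Spec

variable (A : Template QA SA Gd) (B : Template QB SB Gd)
variable (sat : Set (QA ⊕ QB) → Gd → Prop)

/-- The trace of valuations of the atomic propositions along run `x`, where the `k`
indexed `B`-processes are given by `ι`. -/
def traceK {n k : ℕ} (x : Run A B sat n) (ι : Fin k → Fin n) :
    ℕ → AtomK QA SA QB SB k → Prop := fun t a =>
  match a with
  | Sum.inl (Sum.inl qa) => (x.s t).1 = qa
  | Sum.inl (Sum.inr sa) => (x.e t).1 = sa
  | Sum.inr (Sum.inl qb, i) => (x.s t).2 (ι i) = qb
  | Sum.inr (Sum.inr sb, i) => (x.e t).2 (ι i) = sb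

/-- `(A,B)^{(1,n)} ⊨ ∀ i_1,…,i_k. E h`, relative to a fairness constraint `F` on runs. -/
def satE (k n : ℕ) (F : Run A B sat n → Prop) (h : LTL (AtomK QA SA QB SB k)) : Prop :=
  ∀ ι : Fin k ↪ Fin n, ∃ x : Run A B sat n, F x ∧ LTL.holds (traceK A B sat x ι) h 0

/-- `(A,B)^{(1,n)} ⊨ ∀ i_1,…,i_k. A h`, relative to a fairness constraint `F` on runs. -/
def satA (k n : ℕ) (F : Run A B sat n → Prop) (h : LTL (AtomK QA SA QB SB k)) : Prop :=
  ∀ ι : Fin k ↪ Fin n, ∀ x : Run A B sat n, F x → LTL.holds (traceK A B sat x ι) h 0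

/-- `c` is a cutoff for `k`-indexed `LTL\X` properties (w.r.t. fairness `F`). -/
def kCutoff (F : ∀ n, Run A B sat n → Prop) (k c : ℕ) : Prop :=
  ∀ (h : LTL (AtomK QA SA QB SB k)) (n : ℕ), c ≤ n →
    ((satE A B sat k n (F n) h ↔ satE A B sat k c (F c) h) ∧
     (satA A B sat k n (F n) h ↔ satA A B sat k c (F c) h))

end Spec

/-- All guards appearing in transitions of a template. -/
def guardsOf {Q Sig Gd : Type} (T : Template Q Sig Gd) : Set Gd :=
  {g | ∃ q σ q', (q, σ, g, q') ∈ T.trans}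

/-- The non-trivial guards of a template (different from `Q_A ∪ Q_B` and `∅`). -/
def ntGuards {Q Sig St : Type} (T : Template Q Sig (Set St)) : Set (Set St) :=
  {g | g ∈ guardsOf T ∧ g ≠ Set.univ ∧ g ≠ ∅}

/-- `|G| = |G_A ∪ G_B|`, the number of non-trivial guards of the system. -/
noncomputable def numG (A : Template QA SA (Set (QA ⊕ QB))) (B : Template QB SB (Set (QA ⊕ QB))) : ℕ :=
  (ntGuards A ∪ ntGuards B).ncard

/-- `Enable_q`: the states of `A` and `B` that enable some transition from `q` in `B`. -/
def EnableSet (B : Template QB SB (Set (QA ⊕ QB))) (q : QB) : Set (QA ⊕ QB) :=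
  {x | ∃ σ g q'', (q, σ, g, q'') ∈ B.trans ∧ x ∈ g}

section Conj

variable (A : Template QA SA (Set (QA ⊕ QB))) (B : Template QB SB (Set (QA ⊕ QB)))

/-- The standing assumption on conjunctive systems: `init_A` and `init_B`
are contained in all guards. -/
def conjInitAssumption : Prop :=
  ∀ g ∈ guardsOf A ∪ guardsOf B, Sum.inl A.init ∈ g ∧ Sum.inr B.init ∈ g

/-- The guards of the transitions from a local state of the system. -/
def guardsFrom : QA ⊕ QB → Set (Set (QA ⊕ QB))
  | Sum.inl q => {g | ∃ σ q', (q, σ, g, q') ∈ A.trans}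
  | Sum.inr q => {g | ∃ σ q', (q, σ, g, q') ∈ B.trans}

/-- `D` is a deadset of state `st` (contains at most one `A`-state, hits every guard of a
transition from `st`, and each of its members violates some guard from `st`). -/
def IsDeadset (st : QA ⊕ QB) (D : Set (QA ⊕ QB)) : Prop :=
  (∀ x ∈ D, ∀ y ∈ D, x.isLeft → y.isLeft → x = y) ∧
  (∀ g ∈ guardsFrom A B st, ∃ x ∈ D, x ∉ g) ∧
  (∀ x ∈ D, ∃ g ∈ guardsFrom A B st, x ∉ g)

/-- A state is free if it has no deadset. -/
def IsFreeState (st : QA ⊕ QB) : Prop := ¬ ∃ D, IsDeadset A B st D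

/-- A state is non-blocking if it appears in no deadset of any state. -/
def IsNonBlocking (x : QA ⊕ QB) : Prop := ∀ st D, IsDeadset A B st D → x ∉ D

/-- A state is not self-blocking if it appears in no deadset of itself. -/
def IsNotSelfBlocking (st : QA ⊕ QB) : Prop := ∀ D, IsDeadset A B st D → st ∉ D

/-- A locally deadlocked run that is alternation-free: eventually one single deadset of the
deadlocked state remains covered forever (no infinite alternation between deadsets). -/
def altFreeLockedRun {n : ℕ} (x : Run A B conjSat n) (p : Proc n) : Prop :=
  ∃ t0 D, (∀ t ≥ t0, ¬ enabled A B conjSat (x.s t) (x.e t) p) ∧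
    IsDeadset A B (view (x.s t0) p) D ∧ ∀ t ≥ t0, D ⊆ others (x.s t) p

end Conj

section UProps

variable {QU SU : Type}
variable (U : Template QU SU (Set (QA ⊕ QB))) (emb : QU → QA ⊕ QB)

/-- Guards of transitions from state `q` of template `U`. -/
def uGFrom (q : QU) : Set (Set (QA ⊕ QB)) := {g | ∃ σ q', (q, σ, g, q') ∈ U.trans}

/-- A deadset of state `q` of template `U`. -/
def uDeadset (q : QU) (D : Set (QA ⊕ QB)) : Prop :=
  (∀ x ∈ D, ∀ y ∈ D, x.isLeft → y.isLeft → x = y) ∧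
  (∀ g ∈ uGFrom U q, ∃ x ∈ D, x ∉ g) ∧
  (∀ x ∈ D, ∃ g ∈ uGFrom U q, x ∉ g)

/-- A state of `U` is free if it has no deadset. -/
def uFreeState (q : QU) : Prop := ¬ ∃ D, uDeadset U q D

/-- A `1`-conjunctive guard excludes exactly one state. -/
def OneConjGuard (g : Set (QA ⊕ QB)) : Prop := ∃ x : QA ⊕ QB, g = {x}ᶜ

/-- A state is `1`-conjunctive if all its non-trivial guards are `1`-conjunctive. -/
def uOneConjState (q : QU) : Prop :=
  ∀ g ∈ uGFrom U q, g ≠ Set.univ → g ≠ ∅ → OneConjGuard g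

/-- A template is `1`-conjunctive if all its states are. -/
def uOneConj : Prop := ∀ q : QU, uOneConjState U q

/-- Effectively `1`-conjunctive: every state is `1`-conjunctive or free. -/
def uEff1Conj : Prop := ∀ q : QU, uOneConjState U q ∨ uFreeState U q

/-- Transitions of `U`, as quadruples. -/
abbrev Edge (QU SU St : Type) := QU × SU × Set St × QU

def esrc {St : Type} (e : Edge QU SU St) : QU := e.1
def etgt {St : Type} (e : Edge QU SU St) : QU := e.2.2.2
def egrd {St : Type} (e : Edge QU SU St) : Set St := e.2.2.1

/-- A connected sequence of transitions of `U`. -/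
def uEPath (l : List (Edge QU SU (QA ⊕ QB))) : Prop :=
  (∀ e ∈ l, e ∈ U.trans) ∧ l.Chain' (fun e e' => etgt e = esrc e')

/-- A cycle through `q`: a nonempty connected transition sequence from `q` back to `q`
visiting pairwise distinct states. -/
def uIsCycle (q : QU) (l : List (Edge QU SU (QA ⊕ QB))) : Prop :=
  l ≠ [] ∧ uEPath U l ∧
  (∃ e0 ∈ l.head?, esrc e0 = q) ∧ (∃ en ∈ l.getLast?, etgt en = q) ∧
  (l.map esrc).Nodup

/-- The states on a cycle (or transition sequence). -/
def cycStates {St : Type} (l : List (Edge QU SU St)) : Set QU := {s | ∃ e ∈ l, esrc e = s}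

/-- The guards on a cycle (or transition sequence). -/
def cycGuards {St : Type} (l : List (Edge QU SU St)) : Set (Set St) := {g | ∃ e ∈ l, egrd e = g}

/-- A lasso: a connected transition sequence starting at the initial state and
ending with a cycle. -/
def uIsLasso (l : List (Edge QU SU (QA ⊕ QB))) : Prop :=
  uEPath U l ∧ (∃ e0 ∈ l.head?, esrc e0 = U.init) ∧
  ∃ l1 l2 q, l = l1 ++ l2 ∧ uIsCycle U q l2

/-- `D` disables all `n`-conjunctive guards with `n > 1` of transitions from `q`. -/
def uDisablesBig (q : QU) (D : Set (QA ⊕ QB)) : Prop :=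
  ∀ g ∈ uGFrom U q, g ≠ Set.univ → 2 ≤ (gᶜ).ncard → ∃ x ∈ D, x ∉ g

/-- Freely traversable template: for every non-free state `q` and every set of states
disabling the `n`-conjunctive guards (`n > 1`) from `q`, there is a lasso whose guards
avoid `¬q`, avoid all `¬q_i`, and avoid all `1`-conjunctive guards from `q`. -/
def uFreelyTraversable : Prop :=
  ∀ q : QU, ¬ uFreeState U q → ∀ D, uDisablesBig U q D →
    ∃ l, uIsLasso U l ∧ ∀ g ∈ cycGuards l,
      emb q ∈ g ∧ (∀ x ∈ D, x ∈ g) ∧ ∀ x : QA ⊕ QB, ({x}ᶜ ∈ uGFrom U q) → x ∈ g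

/-- `x` has a cycle through it that is disjoint from all cycles through `q` and
whose guards never exclude `q`. -/
def uBadCycleFor (q : QU) (x : QA ⊕ QB) : Prop :=
  ∃ qx : QU, emb qx = x ∧ ∃ c, uIsCycle U qx c ∧
    (∀ s ∈ cycStates c, ¬ ∃ cq, uIsCycle U q cq ∧ s ∈ cycStates cq) ∧
    (∀ g ∈ cycGuards c, emb q ∈ g)

/-- Alternation-free template. -/
def uAltFree : Prop :=
  (∀ q : QU, ¬ uFreeState U q → ∀ D, uDisablesBig U q D →
    ∀ x ∈ D, ∀ y ∈ D, uBadCycleFor U emb q x → uBadCycleFor U emb q y → x = y) ∨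
  (∀ q : QU, ¬ uFreeState U q → ∀ g ∈ uGFrom U q, 2 ≤ (gᶜ).ncard →
    ∃ x ∈ gᶜ, {x}ᶜ ∈ uGFrom U q)

end UProps


/-- `LTL\X` formulas cannot distinguish a trace from a stuttering of it. -/
theorem LTL.holds_comp_iff {P : Type} (w : ℕ → P → Prop) {φ : ℕ → ℕ} (hm : Monotone φ)
    (hs : Function.Surjective φ) (h : LTL P) :
    ∀ t, LTL.holds (fun u => w (φ u)) h t ↔ LTL.holds w h (φ t) := by
  induction h with
  | atom a => intro t; rfl
  | tru => intro t; rfl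
  | not f ih => intro t; simp only [LTL.holds, ih]
  | and f g ihf ihg => intro t; simp only [LTL.holds, ihf, ihg]
  | untl f g ihf ihg =>
    intro t
    simp only [LTL.holds, ihf, ihg]
    constructor
    · rintro ⟨t', htt', hg, hf⟩
      refine ⟨φ t', hm htt', hg, fun u hu hut' => ?_⟩
      rcases hu.eq_or_lt with rfl | hlt
      · exact hf t le_rfl (hm.reflect_lt hut')
      · obtain ⟨v, rfl⟩ := hs u
        exact hf v (hm.reflect_lt hlt).le (hm.reflect_lt hut')
    · rintro ⟨T, hT, hg, hf⟩
      have hex : ∃ v, t ≤ v ∧ φ v = T := by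
        rcases hT.eq_or_lt with rfl | hlt
        · exact ⟨t, le_rfl, rfl⟩
        · obtain ⟨v, rfl⟩ := hs T
          exact ⟨v, (hm.reflect_lt hlt).le, rfl⟩
      classical
      obtain ⟨hv, hvT⟩ := Nat.find_spec hex
      refine ⟨Nat.find hex, hv, by rwa [hvT], fun u hu hlt => hf _ (hm hu) ?_⟩
      have hne : φ u ≠ T := fun he => Nat.find_min hex hlt ⟨hu, he⟩
      exact lt_of_le_of_ne (hvT ▸ hm hlt.le) hne

section Simulation

/-- The local transitions of the templates `A` and `B`, on the disjoint union of their states. -/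
def localTrans (A : Template QA SA Gd) (B : Template QB SB Gd) :
    QA ⊕ QB → SA ⊕ SB → Gd → QA ⊕ QB → Prop
  | Sum.inl q, Sum.inl σ, g, Sum.inl q' => (q, σ, g, q') ∈ A.trans
  | Sum.inr q, Sum.inr σ, g, Sum.inr q' => (q, σ, g, q') ∈ B.trans
  | _, _, _, _ => False

theorem localTrans_guard_mem {A : Template QA SA Gd} {B : Template QB SB Gd} {q q' : QA ⊕ QB}
    {σ : SA ⊕ SB} {g : Gd} (h : localTrans A B q σ g q') : g ∈ guardsOf A ∪ guardsOf B := by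
  rcases q with q | q <;> rcases σ with σ | σ <;> rcases q' with q' | q' <;>
    first
      | exact h.elim
      | exact Or.inl ⟨q, σ, q', h⟩
      | exact Or.inr ⟨q, σ, q', h⟩

theorem step_iff (A : Template QA SA Gd) (B : Template QB SB Gd)
    (sat : Set (QA ⊕ QB) → Gd → Prop) {n : ℕ} (s : GState QA QB n) (e : GInput SA SB n)
    (p : Proc n) (s' : GState QA QB n) :
    step A B sat s e p s' ↔
      (∃ g, localTrans A B (view s p) (inp e p) g (view s' p) ∧ sat (others s p) g) ∧
        ∀ q, q ≠ p → view s' q = view s q := by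
  cases p with
  | none =>
    constructor
    · rintro ⟨g, q', h, hsat, rfl⟩
      refine ⟨⟨g, h, hsat⟩, fun q hq => ?_⟩
      cases q with
      | none => exact absurd rfl hq
      | some i => rfl
    · rintro ⟨⟨g, h, hsat⟩, hq⟩
      refine ⟨g, s'.1, h, hsat, Prod.ext rfl (funext fun i => ?_)⟩
      exact Sum.inr_injective (hq (some i) (by simp))
  | some i =>
    constructor
    · rintro ⟨g, q', h, hsat, rfl⟩
      refine ⟨⟨g, by simpa [view, inp, localTrans] using h, hsat⟩, fun q hq => ?_⟩
      cases q with
      | none => rfl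
      | some j =>
        have : j ≠ i := fun h => hq (h ▸ rfl)
        simp [view, this]
    · rintro ⟨⟨g, h, hsat⟩, hq⟩
      refine ⟨g, s'.2 i, h, hsat, Prod.ext ?_ (funext fun j => ?_)⟩
      · exact Sum.inl_injective (hq none (by simp))
      · by_cases hj : j = i
        · subst hj; simp
        · simpa [hj] using Sum.inr_injective (hq (some j) (by simpa using hj))

theorem view_ext {n : ℕ} {s s' : GState QA QB n} (h : ∀ p, view s p = view s' p) : s = s' :=
  Prod.ext (Sum.inl_injective (h none)) (funext fun i => Sum.inr_injective (h (some i)))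

theorem inp_ext {n : ℕ} {e e' : GInput SA SB n} (h : ∀ p, inp e p = inp e' p) : e = e' :=
  Prod.ext (Sum.inl_injective (h none)) (funext fun i => Sum.inr_injective (h (some i)))

theorem Run.view_succ_of_ne {A : Template QA SA Gd} {B : Template QB SB Gd}
    {sat : Set (QA ⊕ QB) → Gd → Prop} {n : ℕ} (x : Run A B sat n) {t : ℕ} {p : Proc n}
    (h : p ≠ x.mv t) : view (x.s (t + 1)) p = view (x.s t) p :=
  ((step_iff A B sat _ _ _ _).1 (x.steps t)).2 p h

/-- A sequence of configurations in which infinitely many steps are genuine and all others do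
not change anything is a stuttering of a run. -/
theorem exists_run_of_stuttering (A : Template QA SA Gd) (B : Template QB SB Gd)
    (sat : Set (QA ⊕ QB) → Gd → Prop) {n : ℕ} (S : ℕ → GState QA QB n)
    (E : ℕ → GInput SA SB n) (genuine : ℕ → Prop) (h0 : isInit A B (S 0))
    (hgen : ∀ u, genuine u → ∃ p, step A B sat (S u) (E u) p (S (u + 1)) ∧
      ∀ q, q ≠ p → inp (E (u + 1)) q = inp (E u) q)
    (hidle : ∀ u, ¬ genuine u → S (u + 1) = S u ∧ E (u + 1) = E u)
    (hinf : ∀ u, ∃ v ≥ u, genuine v) :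
    ∃ (y : Run A B sat n) (ψ : ℕ → ℕ), Monotone ψ ∧ Function.Surjective ψ ∧
      ∀ u, y.s (ψ u) = S u ∧ y.e (ψ u) = E u := by
  classical
  have hI : {u | genuine u}.Infinite := Set.infinite_of_not_bddAbove fun ⟨b, hb⟩ => by
    obtain ⟨v, hv, hg⟩ := hinf (b + 1)
    have : v ≤ b := hb hg
    omega
  have hconst : ∀ u v, u ≤ v → (∀ w, u ≤ w → w < v → ¬ genuine w) →
      S v = S u ∧ E v = E u := by
    intro u v huv
    induction v, huv using Nat.le_induction with
    | base => intro _; exact ⟨rfl, rfl⟩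
    | succ v huv ih =>
      intro hw
      obtain ⟨h1, h2⟩ := ih fun w h h' => hw w h (by omega)
      obtain ⟨h3, h4⟩ := hidle v (hw v huv (by omega))
      exact ⟨h3.trans h1, h4.trans h2⟩
  have hnext : ∀ u, S (Nat.nth genuine (Nat.count genuine u)) = S u ∧
      E (Nat.nth genuine (Nat.count genuine u)) = E u := by
    intro u
    refine hconst u _ (Nat.le_nth_count hI u) fun w huw hw hg => ?_
    have h1 : Nat.nth genuine (Nat.count genuine u) ≤ Nat.nth genuine (Nat.count genuine w) :=
      Nat.nth_monotone hI (Nat.count_monotone genuine huw)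
    rw [Nat.nth_count hg] at h1
    omega
  have hsucc : ∀ a, S (Nat.nth genuine (a + 1)) = S (Nat.nth genuine a + 1) ∧
      E (Nat.nth genuine (a + 1)) = E (Nat.nth genuine a + 1) := by
    intro a
    have h := hnext (Nat.nth genuine a + 1)
    rwa [Nat.count_succ, if_pos (Nat.nth_mem_of_infinite hI a),
      Nat.count_nth_of_infinite hI] at h
  choose mv hmv using fun a => hgen _ (Nat.nth_mem_of_infinite hI a)
  refine ⟨⟨fun a => S (Nat.nth genuine a), fun a => E (Nat.nth genuine a), mv, ?_, ?_, ?_⟩,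
    Nat.count genuine, Nat.count_monotone genuine,
    fun a => ⟨_, Nat.count_nth_of_infinite hI a⟩, hnext⟩
  · have h := (hnext 0).1
    rw [Nat.count_zero] at h
    simpa only [h] using h0
  · intro a
    simpa only [(hsucc a).1] using (hmv a).1
  · intro a p hp
    simpa only [(hsucc a).2] using (hmv a).2 p hp

/-- Idle processes can be added to a run of a disjunctive system. -/
theorem exists_run_extend {A : Template QA SA (Set (QA ⊕ QB))} {B : Template QB SB (Set (QA ⊕ QB))}
    {c n : ℕ} (x : Run A B disjSat c) (j : Fin c ↪ Fin n) (σ : SB) :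
    ∃ y : Run A B disjSat n, ∀ t, (y.s t).1 = (x.s t).1 ∧ (y.e t).1 = (x.e t).1 ∧
      ∀ i, (y.s t).2 (j i) = (x.s t).2 i ∧ (y.e t).2 (j i) = (x.e t).2 i := by
  let S : ℕ → GState QA QB n := fun t => ((x.s t).1, Function.extend j (x.s t).2 fun _ => B.init)
  let E : ℕ → GInput SA SB n := fun t => ((x.e t).1, Function.extend j (x.e t).2 fun _ => σ)
  have hj : Function.Injective (Option.map j) := Option.map_injective j.injective
  have hS : ∀ t p, view (S t) (Option.map j p) = view (x.s t) p := by
    rintro t (_ | i)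
    · rfl
    · simp [S, view, j.injective.extend_apply]
  have hE : ∀ t p, inp (E t) (Option.map j p) = inp (x.e t) p := by
    rintro t (_ | i)
    · rfl
    · simp [E, inp, j.injective.extend_apply]
  have hS' : ∀ t t' p, (∀ q, Option.map j q ≠ p) → view (S t) p = view (S t') p := by
    rintro t t' (_ | i) h
    · exact absurd rfl (h none)
    · have hi : ¬ ∃ a, j a = i := fun ⟨a, ha⟩ => h (some a) (by simp [ha])
      simp [S, view, Function.extend_apply' _ _ _ hi]
  have hE' : ∀ t t' p, (∀ q, Option.map j q ≠ p) → inp (E t) p = inp (E t') p := by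
    rintro t t' (_ | i) h
    · exact absurd rfl (h none)
    · have hi : ¬ ∃ a, j a = i := fun ⟨a, ha⟩ => h (some a) (by simp [ha])
      simp [E, inp, Function.extend_apply' _ _ _ hi]
  refine ⟨⟨S, E, fun t => Option.map j (x.mv t), ⟨x.isInit0.1, fun i => ?_⟩, fun t => ?_,
    fun t p hp => ?_⟩, fun t => ⟨rfl, rfl, fun i => ?_⟩⟩
  · by_cases hi : ∃ a, j a = i
    · obtain ⟨a, rfl⟩ := hi
      simpa [S, j.injective.extend_apply] using x.isInit0.2 a
    · simp [S, Function.extend_apply' _ _ _ hi]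
  · obtain ⟨⟨g, hg, y, ⟨p', hp', rfl⟩, hy⟩, hq⟩ := (step_iff _ _ _ _ _ _ _).1 (x.steps t)
    refine (step_iff _ _ _ _ _ _ _).2 ⟨⟨g, by rwa [hS, hE, hS],
      _, ⟨Option.map j p', hj.ne hp', hS t p'⟩, hy⟩, fun q hqne => ?_⟩
    by_cases h : ∃ r, Option.map j r = q
    · obtain ⟨r, rfl⟩ := h
      rw [hS, hS]
      exact hq r fun hr => hqne (hr ▸ rfl)
    · exact hS' _ _ _ (not_exists.1 h)
  · by_cases h : ∃ r, Option.map j r = p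
    · obtain ⟨r, rfl⟩ := h
      rw [hE, hE]
      exact x.persist t r fun hr => hp (hr ▸ rfl)
    · exact hE' _ _ _ (not_exists.1 h)
  · simp [S, E, j.injective.extend_apply]

theorem ntGuards_mem {A : Template QA SA (Set (QA ⊕ QB))} {B : Template QB SB (Set (QA ⊕ QB))}
    {g : Set (QA ⊕ QB)} (h : g ∈ guardsOf A ∪ guardsOf B) (hu : g ≠ Set.univ) (he : g ≠ ∅) :
    g ∈ ntGuards A ∪ ntGuards B :=
  h.imp (fun h => ⟨h, hu, he⟩) fun h => ⟨h, hu, he⟩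

/-- Process `p` of a system with `c` copies of `B` replays the local run of process
`p.map src` of the run `x`, following it up to the local time `clk p t` at time `t`.
Every time unit is divided into `N` slots, and `p` is scheduled in slot `lane p`. -/
theorem exists_run_replay {A : Template QA SA (Set (QA ⊕ QB))}
    {B : Template QB SB (Set (QA ⊕ QB))} {n c : ℕ} (x : Run A B disjSat n)
    (src : Fin c → Fin n) (clk : Proc c → ℕ → ℕ) (N : ℕ) (lane : Proc c → ℕ)
    (hc : 0 < c) (hlane : ∀ p, lane p < N)
    (huniq : ∀ p q, lane p = lane q → p.map src = q.map src → p = q)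
    (hclk0 : ∀ p, clk p 0 = 0)
    (hclk : ∀ p t, clk p (t + 1) = clk p t ∨ (clk p t = t ∧ clk p (t + 1) = t + 1))
    (hA : ∀ t, clk none t = t)
    (hcover : ∀ g ∈ ntGuards A ∪ ntGuards B, ∀ t j, Sum.inr ((x.s t).2 j) ∈ g →
      ∃ i, Sum.inr ((x.s (clk (some i) t)).2 (src i)) ∈ g ∧
        ∀ t' ≥ t, clk (some i) t' = clk (some i) t)
    (hinf : ∃ p, (∀ t, clk p t = t) ∧ ∀ t, ∃ t' ≥ t, x.mv t' = p.map src) :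
    ∃ (y : Run A B disjSat c) (φ ψ : ℕ → ℕ), Monotone φ ∧ Function.Surjective φ ∧
      Monotone ψ ∧ Function.Surjective ψ ∧
      ∀ p, lane p = 0 → (∀ t, clk p t = t) → ∀ u,
        view (y.s (ψ u)) p = view (x.s (φ u)) (p.map src) ∧
        inp (y.e (ψ u)) p = inp (x.e (φ u)) (p.map src) := by
  have hN : 0 < N := (Nat.zero_le _).trans_lt (hlane none)
  let τ : Proc c → ℕ → ℕ := fun p u => (u + (N - 1 - lane p)) / N
  have hτ : ∀ p t r, r < N → τ p (t * N + r) = if r ≤ lane p then t else t + 1 := by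
    intro p t r hr
    have hl := hlane p
    have h1 : t * N + r + (N - 1 - lane p) = r + (N - 1 - lane p) + N * t := by ring
    simp only [τ]
    rw [h1, Nat.add_mul_div_left _ _ hN]
    split_ifs with h
    · rw [Nat.div_eq_of_lt (by omega)]; omega
    · rw [Nat.div_eq_of_lt_le (k := 1) (by omega) (by omega)]; omega
  have hτsucc : ∀ p t r, r < N → τ p (t * N + r + 1) = if r < lane p then t else t + 1 := by
    intro p t r hr
    rcases Nat.lt_or_ge (r + 1) N with h | h
    · rw [add_assoc, hτ p t (r + 1) h]; rfl
    · have hl := hlane p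
      have h2 : t * N + r + 1 = (t + 1) * N + 0 := by rw [Nat.add_mul]; omega
      rw [h2, hτ p (t + 1) 0 hN, if_pos (Nat.zero_le _), if_neg (by omega)]
  have hslot : ∀ u, ∃ t r, r < N ∧ u = t * N + r := fun u =>
    ⟨u / N, u % N, Nat.mod_lt _ hN, (Nat.div_add_mod' u N).symm⟩
  let S : ℕ → GState QA QB c := fun u =>
    ((x.s (clk none (τ none u))).1, fun i => (x.s (clk (some i) (τ (some i) u))).2 (src i))
  let E : ℕ → GInput SA SB c := fun u =>
    ((x.e (clk none (τ none u))).1, fun i => (x.e (clk (some i) (τ (some i) u))).2 (src i))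
  have hS : ∀ u p, view (S u) p = view (x.s (clk p (τ p u))) (p.map src) := by
    rintro u (_ | i) <;> rfl
  have hE : ∀ u p, inp (E u) p = inp (x.e (clk p (τ p u))) (p.map src) := by
    rintro u (_ | i) <;> rfl
  let moves : ℕ → Proc c → Prop := fun u p =>
    u % N = lane p ∧ clk p (u / N) = u / N ∧ clk p (u / N + 1) = u / N + 1 ∧
      x.mv (u / N) = p.map src
  have hdiv : ∀ t r, r < N → (t * N + r) / N = t := fun t r hr => by
    rw [mul_comm, Nat.mul_add_div hN, Nat.div_eq_of_lt hr, add_zero]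
  have hmod : ∀ t r, r < N → (t * N + r) % N = r := fun t r hr => by
    rw [mul_comm, Nat.mul_add_mod, Nat.mod_eq_of_lt hr]
  have hstay : ∀ u p, ¬ moves u p →
      view (S (u + 1)) p = view (S u) p ∧ inp (E (u + 1)) p = inp (E u) p := by
    intro u p hp
    obtain ⟨t, r, hr, rfl⟩ := hslot u
    rw [hS, hS, hE, hE, hτ p t r hr, hτsucc p t r hr]
    rcases lt_trichotomy r (lane p) with h | h | h
    · simp [h, h.le]
    · rw [if_neg (by omega), if_pos (by omega)]
      rcases hclk p t with h' | ⟨h', h''⟩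
      · rw [h']; exact ⟨rfl, rfl⟩
      · have hne : p.map src ≠ x.mv t := fun hmv => hp (by
          simp only [moves, hdiv t r hr, hmod t r hr]
          exact ⟨h, h', h'', hmv.symm⟩)
        rw [h', h'']
        exact ⟨x.view_succ_of_ne hne, x.persist t _ hne⟩
    · simp [h.not_gt, h.not_ge]
  obtain ⟨y, ψ, hψm, hψs, hy⟩ := exists_run_of_stuttering A B disjSat S E (fun u => ∃ p, moves u p)
    (by
      have h0 : ∀ p, τ p 0 = 0 := fun p => Nat.div_eq_of_lt (by omega)
      simp only [isInit, S, h0, hclk0]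
      exact ⟨x.isInit0.1, fun i => x.isInit0.2 _⟩)
    (by
      rintro u ⟨p, hp⟩
      have hother : ∀ q, q ≠ p → ¬ moves u q := fun q hqp hq =>
        hqp (huniq q p (hq.1.symm.trans hp.1) (hq.2.2.2.symm.trans hp.2.2.2))
      refine ⟨p, (step_iff _ _ _ _ _ _ _).2 ⟨?_, fun q hq => (hstay u q (hother q hq)).1⟩,
        fun q hq => (hstay u q (hother q hq)).2⟩
      obtain ⟨t, r, hr, rfl⟩ := hslot u
      obtain ⟨hl, hc1, hc2, hmv⟩ := hp
      rw [hdiv t r hr] at hc1 hc2 hmv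
      rw [hmod t r hr] at hl
      have hstep := x.steps t
      rw [hmv] at hstep
      obtain ⟨⟨g, hg, z, ⟨p', hp', rfl⟩, hz⟩, -⟩ := (step_iff _ _ _ _ _ _ _).1 hstep
      refine ⟨g, ?_, ?_⟩
      · rw [hS, hS, hE, hτ p t r hr, hτsucc p t r hr, if_pos hl.le, if_neg (by omega), hc1, hc2]
        exact hg
      by_cases hu : g = Set.univ
      · cases p with
        | none => exact ⟨_, ⟨some ⟨0, hc⟩, by simp, rfl⟩, by simp [hu]⟩
        | some i => exact ⟨_, ⟨none, by simp, rfl⟩, by simp [hu]⟩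
      cases p' with
      | none =>
        refine ⟨_, ⟨none, fun h => hp' (by simp [← h]), rfl⟩, ?_⟩
        rw [hS, hA, hτ none t r hr, Option.map_none]
        split_ifs
        · exact hz
        · rwa [x.view_succ_of_ne (by rw [hmv]; exact hp')]
      | some j =>
        obtain ⟨i, hi, hfrozen⟩ := hcover g
          (ntGuards_mem (localTrans_guard_mem hg) hu (Set.nonempty_iff_ne_empty.1 ⟨_, hz⟩)) t j hz
        refine ⟨_, ⟨some i, ?_, rfl⟩, ?_⟩
        · rintro rfl
          have := hfrozen (t + 1) (by omega)
          omega
        · rw [hS, hfrozen (τ (some i) (t * N + r))]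
          · exact hi
          · rw [hτ _ t r hr]; split_ifs <;> omega)
    (fun u hu => ⟨view_ext fun p => (hstay u p fun h => hu ⟨p, h⟩).1,
      inp_ext fun p => (hstay u p fun h => hu ⟨p, h⟩).2⟩)
    (by
      intro u
      obtain ⟨p, hp, hmv⟩ := hinf
      obtain ⟨t, ht, hmvt⟩ := hmv u
      refine ⟨t * N + lane p, ?_, p, ?_⟩
      · have := Nat.le_mul_of_pos_right t hN
        omega
      · simp only [moves, hdiv t _ (hlane p), hmod t _ (hlane p), hp, hmvt, and_self])
  refine ⟨y, fun u => (u + (N - 1)) / N, ψ, fun a b hab => Nat.div_le_div_right (by omega),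
    fun t => ⟨t * N, ?_⟩, hψm, hψs, fun p hp0 hp u => ?_⟩
  · have := hdiv t (N - 1) (by omega)
    exact this
  · rw [(hy u).1, (hy u).2, hS, hE, hp]
    simp only [τ, hp0, Nat.sub_zero, and_self]

end Simulation

section Cutoff

variable {A : Template QA SA (Set (QA ⊕ QB))} {B : Template QB SB (Set (QA ⊕ QB))}

theorem holds_extend {k c n : ℕ} (ι' : Fin k ↪ Fin c) (ι : Fin k ↪ Fin n) (hc : 0 < c)
    (hcn : c ≤ n) (h : LTL (AtomK QA SA QB SB k)) (x : Run A B disjSat c)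
    (hx : LTL.holds (traceK A B disjSat x ι') h 0) :
    ∃ y : Run A B disjSat n, LTL.holds (traceK A B disjSat y ι) h 0 := by
  obtain ⟨j, hj⟩ : ∃ j : Fin c ↪ Fin n, ∀ a, j (ι' a) = ι a := by
    let f : Fin c ↪ Fin n := Fin.castLEEmb hcn
    obtain ⟨σ, hσ⟩ := Equiv.Perm.exists_extending_pair (ι'.trans f) ι
      (ι'.trans f).injective ι.injective
    exact ⟨f.trans σ.toEmbedding, hσ⟩
  obtain ⟨y, hy⟩ := exists_run_extend x j ((x.e 0).2 ⟨0, hc⟩)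
  refine ⟨y, ?_⟩
  have htr : traceK A B disjSat y ι = traceK A B disjSat x ι' := by
    funext t a
    obtain ⟨h1, h2, h3⟩ := hy t
    rcases a with (q | σ) | ⟨q | σ, i⟩ <;> simp only [traceK, h1, h2, ← hj, h3]
  rwa [htr]

/-- The reduction to fewer processes: one process per set `W l` moves to the first state in `W l`
reached in the given run and stays there, the indexed processes are copied, and one more
process ensures that the resulting run is infinite. -/
theorem holds_reduce {J : Type} [Finite J] (W : J → Set QB)
    (hW : ∀ g ∈ ntGuards A ∪ ntGuards B, ∀ q, Sum.inr q ∈ g →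
      ∃ l, q ∈ W l ∧ ∀ q' ∈ W l, Sum.inr q' ∈ g)
    {k n : ℕ} (ι' : Fin k ↪ Fin (Nat.card J + k + 1)) (ι : Fin k ↪ Fin n) (hn : 0 < n)
    (h : LTL (AtomK QA SA QB SB k)) (x : Run A B disjSat n)
    (hx : LTL.holds (traceK A B disjSat x ι) h 0) :
    ∃ y : Run A B disjSat (Nat.card J + k + 1), LTL.holds (traceK A B disjSat y ι') h 0 := by
  classical
  obtain ⟨e, he⟩ : ∃ e : Fin (Nat.card J + k + 1) ≃ Fin k ⊕ Option J,
      ∀ a, e (ι' a) = Sum.inl a := by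
    have : Fintype J := Fintype.ofFinite J
    have e₀ : Fin (Nat.card J + k + 1) ≃ Fin k ⊕ Option J :=
      Fintype.equivOfCardEq (by simp [Nat.card_eq_fintype_card]; omega)
    obtain ⟨σ, hσ⟩ := Equiv.Perm.exists_extending_pair (fun a => e₀ (ι' a)) Sum.inl
      (e₀.injective.comp ι'.injective) Sum.inl_injective
    exact ⟨e₀.trans σ, hσ⟩
  have hfirst : ∀ l, ∃ (T : ℕ) (j : Fin n), ∀ t j', (x.s t).2 j' ∈ W l →
      T ≤ t ∧ (x.s T).2 j ∈ W l := by
    intro l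
    by_cases hl : ∃ t, ∃ j, (x.s t).2 j ∈ W l
    · obtain ⟨j, hj⟩ := Nat.find_spec hl
      exact ⟨Nat.find hl, j, fun t j' h => ⟨Nat.find_min' hl ⟨j', h⟩, hj⟩⟩
    · exact ⟨0, ⟨0, hn⟩, fun t j' h => absurd ⟨t, j', h⟩ hl⟩
  choose T first hfirst using hfirst
  obtain ⟨p₀, hp₀⟩ : ∃ p₀ : Proc n, ∀ t, ∃ t' ≥ t, x.mv t' = p₀ := by
    obtain ⟨p₀, hp₀⟩ := Finite.exists_infinite_fiber x.mv
    rw [Set.infinite_coe_iff] at hp₀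
    refine ⟨p₀, fun t => ?_⟩
    obtain ⟨t', ht', hlt⟩ := hp₀.exists_gt t
    exact ⟨t', hlt.le, ht'⟩
  let src' : Fin k ⊕ Option J → Fin n := Sum.elim ι fun l => l.elim (p₀.getD ⟨0, hn⟩) first
  let clk' : Fin k ⊕ Option J → ℕ → ℕ := Sum.elim (fun _ t => t) fun l t =>
    l.elim t fun l => min t (T l)
  let clk : Proc (Nat.card J + k + 1) → ℕ → ℕ := fun p t => p.elim t fun i => clk' (e i) t
  let lane : Proc (Nat.card J + k + 1) → ℕ := fun p => p.elim 0 fun i =>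
    if (e i).isLeft then 0 else i + 1
  have hclk' : ∀ i, (∀ t, clk' i t = t) ∨ ∃ l, ∀ t, clk' i t = min t (T l) := by
    rintro (a | _ | l)
    · exact Or.inl fun _ => rfl
    · exact Or.inl fun _ => rfl
    · exact Or.inr ⟨l, fun _ => rfl⟩
  have hclk : ∀ p, (∀ t, clk p t = t) ∨ ∃ l, ∀ t, clk p t = min t (T l) := by
    rintro (_ | i)
    · exact Or.inl fun _ => rfl
    · exact hclk' (e i)
  obtain ⟨y, φ, ψ, hφm, hφs, hψm, hψs, hy⟩ := exists_run_replay x (fun i => src' (e i)) clk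
    (Nat.card J + k + 2) lane (Nat.succ_pos _)
    (by
      rintro (_ | i)
      · exact Nat.succ_pos _
      · have := i.2
        simp only [lane, Option.elim_some]
        split_ifs <;> omega)
    (by
      rintro (_ | i) (_ | i') hl hs
      · rfl
      · simp at hs
      · simp at hs
      · simp only [lane, Option.elim_some] at hl
        simp only [Option.map_some, Option.some.injEq] at hs ⊢
        split_ifs at hl with h1 h2 h2
        · obtain ⟨a, ha⟩ := Sum.isLeft_iff.1 h1
          obtain ⟨b, hb⟩ := Sum.isLeft_iff.1 h2
          rw [ha, hb] at hs
          have hab : a = b := ι.injective hs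
          exact e.injective (by rw [ha, hb, hab])
        · omega)
    (fun p => by rcases hclk p with h | ⟨l, h⟩ <;> simp [h])
    (fun p t => by
      rcases hclk p with h | ⟨l, h⟩
      · exact Or.inr ⟨h t, h _⟩
      · rw [h, h]; omega)
    (fun t => rfl)
    (by
      intro g hg t j hj
      obtain ⟨l, hl, hlg⟩ := hW g hg _ hj
      obtain ⟨hT, hTl⟩ := hfirst l t j hl
      refine ⟨e.symm (Sum.inr (some l)), ?_, fun t' ht' => ?_⟩
      · simpa [clk, clk', src', hT] using hlg _ hTl
      · simp only [clk, clk', Option.elim_some, Equiv.apply_symm_apply, Sum.elim_inr]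
        omega)
    (by
      cases p₀ with
      | none => exact ⟨none, fun _ => rfl, hp₀⟩
      | some j =>
        refine ⟨some (e.symm (Sum.inr none)), fun t => ?_, ?_⟩
        · simp [clk, clk']
        · simpa [src'] using hp₀)
  refine ⟨y, ?_⟩
  have hvis : ∀ a u, view (y.s (ψ u)) (some (ι' a)) = view (x.s (φ u)) (some (ι a)) ∧
      inp (y.e (ψ u)) (some (ι' a)) = inp (x.e (φ u)) (some (ι a)) := by
    intro a u
    simpa [src', he] using
      hy (some (ι' a)) (by simp [lane, he]) (fun t => by simp [clk, clk', he]) u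
  have hvisA := hy none rfl fun _ => rfl
  have htr : (fun u => traceK A B disjSat y ι' (ψ u)) =
      fun u => traceK A B disjSat x ι (φ u) := by
    funext u a
    have h1 : (y.s (ψ u)).1 = (x.s (φ u)).1 := Sum.inl_injective (hvisA u).1
    have h2 : (y.e (ψ u)).1 = (x.e (φ u)).1 := Sum.inl_injective (hvisA u).2
    have h3 : ∀ i, (y.s (ψ u)).2 (ι' i) = (x.s (φ u)).2 (ι i) := fun i =>
      Sum.inr_injective (hvis i u).1
    have h4 : ∀ i, (y.e (ψ u)).2 (ι' i) = (x.e (φ u)).2 (ι i) := fun i =>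
      Sum.inr_injective (hvis i u).2
    rcases a with (q | σ) | ⟨q | σ, i⟩ <;> simp only [traceK, h1, h2, h3, h4]
  have hzero : ∀ {f : ℕ → ℕ}, Monotone f → Function.Surjective f → f 0 = 0 := fun hm hs => by
    obtain ⟨a, ha⟩ := hs 0
    exact Nat.le_zero.1 ((hm (Nat.zero_le a)).trans_eq ha)
  rw [← hzero hφm hφs, ← LTL.holds_comp_iff _ hφm hφs, ← htr,
    LTL.holds_comp_iff _ hψm hψs, hzero hψm hψs] at hx
  exact hx

/-- If the sets `W l` cover the `B`-states of every non-trivial guard from within, then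
one process per set, `k` indexed processes and one more process form a cutoff. -/
theorem kCutoff_of_cover {J : Type} [Finite J] (W : J → Set QB)
    (hW : ∀ g ∈ ntGuards A ∪ ntGuards B, ∀ q, Sum.inr q ∈ g →
      ∃ l, q ∈ W l ∧ ∀ q' ∈ W l, Sum.inr q' ∈ g) (k : ℕ) :
    kCutoff A B disjSat (fun _ _ => True) k (Nat.card J + k + 1) := by
  intro h n hn
  have key : ∀ (h : LTL (AtomK QA SA QB SB k)) (ι : Fin k ↪ Fin n)
      (ι' : Fin k ↪ Fin (Nat.card J + k + 1)),
      (∃ x : Run A B disjSat n, LTL.holds (traceK A B disjSat x ι) h 0) ↔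
        ∃ y : Run A B disjSat (Nat.card J + k + 1), LTL.holds (traceK A B disjSat y ι') h 0 :=
    fun h ι ι' => ⟨fun ⟨x, hx⟩ => holds_reduce W hW ι' ι (by omega) h x hx,
      fun ⟨y, hy⟩ => holds_extend ι' ι (Nat.succ_pos _) hn h y hy⟩
  have ι₀ : Fin k ↪ Fin n := Fin.castLEEmb (by omega)
  have ι₁ : Fin k ↪ Fin (Nat.card J + k + 1) := Fin.castLEEmb (by omega)
  constructor
  · simp only [satE, true_and]
    exact ⟨fun H ι' => (key h ι₀ ι').1 (H ι₀), fun H ι => (key h ι ι₁).2 (H ι₁)⟩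
  · simp only [satA, true_imp_iff]
    constructor
    · intro H ι' y
      by_contra hy
      obtain ⟨x, hx⟩ := (key (.not h) ι₀ ι').2 ⟨y, hy⟩
      exact hx (H ι₀ x)
    · intro H ι x
      by_contra hx
      obtain ⟨y, hy⟩ := (key (.not h) ι ι₁).1 ⟨x, hx⟩
      exact hy (H ι₁ y)

end Cutoff

/-- **Disjunctive Cutoff Theorem (k-indexed LTL\X, non-fair executions).**
For disjunctive systems, both `|B|_G + k + 1` and `|G| + k + 1` are cutoffs for
`k`-indexed `LTL\X` properties, where `G = G_A ∪ G_B` is the set of non-trivial guards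
and `|B|_G` is the number of `B`-states occurring in some guard in `G`. -/
theorem disjunctive_kindexed_nonfair_cutoff
    (QA QB SA SB : Type) [Fintype QA] [Fintype QB] [Fintype SA] [Fintype SB]
    (A : Template QA SA (Set (QA ⊕ QB))) (B : Template QB SB (Set (QA ⊕ QB))) (k : ℕ) :
    kCutoff A B disjSat (fun _ _ => True) k
      (({q : QB | ∃ g ∈ ntGuards A ∪ ntGuards B, Sum.inr q ∈ g}).ncard + k + 1) ∧
    kCutoff A B disjSat (fun _ _ => True) k (numG A B + k + 1) := by
  constructor
  · refine kCutoff_of_cover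
      (fun q : {q : QB | ∃ g ∈ ntGuards A ∪ ntGuards B, Sum.inr q ∈ g} => {q.1}) ?_ k
    rintro g hg q hq
    exact ⟨⟨q, g, hg, hq⟩, rfl, fun q' hq' => by rwa [Set.mem_singleton_iff.1 hq']⟩
  · refine kCutoff_of_cover (fun g : ↥(ntGuards A ∪ ntGuards B) => Sum.inr ⁻¹' g.1) ?_ k
    exact fun g hg q hq => ⟨⟨g, hg⟩, hq, fun q' hq' => hq'⟩
end GP
end

section
/- For disjunctive systems, |B| + |N*| is a cutoff for global deadlock detection, where N = {q ∈ Q_B : q ∈ Enable_q} and N* is a maximum-cardinality subset of N such that for all q_i, q_j ∈ N*: q_i ∉ Enable_{q_j} and q_j ∉ Enable_{q_i}. That is, for all n ≥ |B| + |N*|: (A,B)^(1,n) has a global deadlock iff (A,B)^(1,|B|+|N*|) has a global deadlock. -/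
namespace GP

variable {QA QB SA SB Gd : Type}

section Trails

variable {Q : Type} {n : ℕ}

/-- In the `t`-th step of the run with local states `x` and moving processes `mv`, a process
may stay where it is or take the transition of the process that moves. -/
def Follows (x : ℕ → Fin n → Q) (mv : ℕ → Proc n) (t : ℕ) (y z : Q) : Prop :=
  z = y ∨ ∃ p, mv t = some p ∧ y = x t p ∧ z = x (t + 1) p

/-- `g` is the itinerary, between times `a` and `b`, of a process that only takes transitions
taken in the run at the same moment. -/
def IsTrail (x : ℕ → Fin n → Q) (mv : ℕ → Proc n) (a b : ℕ) (g : ℕ → Q) : Prop :=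
  ∀ t, a ≤ t → t < b → Follows x mv t (g t) (g (t + 1))

/-- Some trail starts at the state of `p` at time `u`, stays there for one step (if `u < m`),
and is in `q` at time `u'`. -/
def Linked (x : ℕ → Fin n → Q) (mv : ℕ → Proc n) (m u : ℕ) (p : Fin n) (u' : ℕ) (q : Q) : Prop :=
  ∃ g, IsTrail x mv u u' g ∧ g u = x u p ∧ (u < m → g (u + 1) = x u p) ∧ g u' = q

variable {x : ℕ → Fin n → Q} {mv : ℕ → Proc n} {m : ℕ}

lemma isTrail_process (hmv : ∀ t < m, ∀ p, mv t ≠ some p → x (t + 1) p = x t p)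
    (a : ℕ) {b : ℕ} (hb : b ≤ m) (p : Fin n) : IsTrail x mv a b (fun t => x t p) := by
  intro t _ htb
  by_cases h : mv t = some p
  · exact Or.inr ⟨p, h, rfl, rfl⟩
  · exact Or.inl (hmv t (by omega) p h)

lemma IsTrail.glue {a b c : ℕ} {g₁ g₂ : ℕ → Q} (h₁ : IsTrail x mv a b g₁)
    (h₂ : IsTrail x mv b c g₂) (h : g₁ b = g₂ b) :
    ∃ g, IsTrail x mv a c g ∧ (∀ t ≤ b, g t = g₁ t) ∧ ∀ t, b ≤ t → g t = g₂ t := by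
  obtain ⟨g, e₁, e₂⟩ : ∃ g : ℕ → Q, (∀ t ≤ b, g t = g₁ t) ∧ ∀ t, b ≤ t → g t = g₂ t := by
    refine ⟨fun t => if t ≤ b then g₁ t else g₂ t, fun t ht => by simp [ht], fun t ht => ?_⟩
    rcases ht.eq_or_lt with rfl | ht
    · simp [h]
    · simp [ht]
  refine ⟨g, fun t hat htc => ?_, e₁, e₂⟩
  by_cases htb : t < b
  · rw [e₁ t htb.le, e₁ (t + 1) htb]
    exact h₁ t hat htb
  · rw [e₂ t (by omega), e₂ (t + 1) (by omega)]
    exact h₂ t (by omega) htc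

variable {P : ℕ → Fin n → Prop}

/-- Chaining up the marked positions of a run, with at most as many chains as local states. -/
lemma exists_chain_map [Fintype Q] {k : ℕ} (hk : Fintype.card Q ≤ k)
    (hmv : ∀ t < m, ∀ p, mv t ≠ some p → x (t + 1) p = x t p)
    (hle : ∀ u p, P u p → u ≤ m)
    (hinj : ∀ u p p', P u p → P u p' → x u p = x u p' → p = p')
    (hstay : ∀ u p, P u p → u < m → x (u + 1) p = x u p)
    (hlast : ∀ p, P m p ↔ ∀ p', x m p' = x m p → p' = p) :
    ∃ σ : {v : ℕ × Fin n // P v.1 v.2} → {v : ℕ × Fin n // P v.1 v.2} ⊕ Fin k,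
      Function.Injective σ ∧
      (∀ v w, σ v = Sum.inl w → v.1.1 < w.1.1 ∧
        Linked x mv m v.1.1 v.1.2 w.1.1 (x w.1.1 w.1.2)) ∧
      (∀ v i, σ v = Sum.inr i → ∃ r, Linked x mv m v.1.1 v.1.2 m (x m r) ∧
        (v.1.1 = m ∨ ∃ r', r' ≠ r ∧ x m r' = x m r)) := by
  classical
  let V := {v : ℕ × Fin n // P v.1 v.2}
  have : Finite V := by
    refine Finite.of_injective
      (fun v : V => ((⟨v.1.1, Nat.lt_succ_of_le (hle _ _ v.2)⟩, v.1.2) : Fin (m + 1) × Fin n)) ?_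
    rintro ⟨⟨u, p⟩, h⟩ ⟨⟨u', p'⟩, h'⟩ heq
    exact Subtype.ext (by simpa using heq)
  have : Fintype V := Fintype.ofFinite V
  let up : V → V → Prop := fun v w => v.1.1 < w.1.1 ∧
    Linked x mv m v.1.1 v.1.2 w.1.1 (x w.1.1 w.1.2)
  let fin : V → Prop := fun v => ∃ r, Linked x mv m v.1.1 v.1.2 m (x m r) ∧
    (v.1.1 = m ∨ ∃ r', r' ≠ r ∧ x m r' = x m r)
  let Γ : V → Finset (V ⊕ Fin k) := fun v =>
    Finset.univ.filter fun z => Sum.elim (up v) (fun _ => fin v) z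
  have hup : ∀ v : V, ¬ fin v → ∀ u', v.1.1 < u' → u' ≤ m →
      Linked x mv m v.1.1 v.1.2 u' (x u' v.1.2) := by
    intro v _ u' hu hu'
    exact ⟨fun t => x t v.1.2, isTrail_process hmv _ hu' _, rfl, fun h => hstay _ _ v.2 h, rfl⟩
  have hnext : ∀ v : V, ¬ fin v → ∃ u, (v.1.1 < u ∧ P u v.1.2) := by
    intro v hv
    have hlt : v.1.1 < m := by
      rcases (hle _ _ v.2).eq_or_lt with h | h
      · refine absurd ⟨v.1.2, ⟨fun t => x t v.1.2, isTrail_process hmv _ le_rfl _, rfl,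
          fun h' => hstay _ _ v.2 h', rfl⟩, Or.inl h⟩ hv
      · exact h
    refine ⟨m, hlt, (hlast _).2 ?_⟩
    intro p' hp'
    by_contra hne
    exact hv ⟨v.1.2, hup v hv m hlt le_rfl, Or.inr ⟨p', hne, hp'⟩⟩
  have hall : ∀ L : Finset V, L.card ≤ (L.biUnion Γ).card := by
    intro L
    by_cases hL : ∃ v ∈ L, fin v
    · obtain ⟨v₀, hv₀, hf⟩ := hL
      let U := L.filter fun w => ∃ v ∈ L, up v w
      let M := L.filter fun w => ¬ ∃ v ∈ L, up v w
      have hM : M.card ≤ k := by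
        refine le_trans ?_ hk
        refine Finset.card_le_card_of_injOn (fun v => x v.1.1 v.1.2) (by simp) ?_
        have key : ∀ v ∈ M, ∀ w ∈ M, x v.1.1 v.1.2 = x w.1.1 w.1.2 → ¬ v.1.1 < w.1.1 := by
          intro v hv w hw h hlt
          exact (Finset.mem_filter.1 hw).2 ⟨v, (Finset.mem_filter.1 hv).1, hlt,
            fun _ => x v.1.1 v.1.2, fun _ _ _ => Or.inl rfl, rfl, fun _ => rfl, h⟩
        intro v hv w hw h
        have h1 := key v hv w hw h
        have h2 := key w hw v hv h.symm
        obtain ⟨⟨u, p⟩, hp⟩ := v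
        obtain ⟨⟨u', p'⟩, hp'⟩ := w
        obtain rfl : u = u' := by simp at h1 h2; omega
        obtain rfl := hinj u p p' hp hp' h
        rfl
      have hsub : U.disjSum (Finset.univ : Finset (Fin k)) ⊆ L.biUnion Γ := by
        intro z hz
        rw [Finset.mem_biUnion]
        rcases z with w | i
        · obtain ⟨v, hv, hvw⟩ := (Finset.mem_filter.1 (Finset.inl_mem_disjSum.1 hz)).2
          exact ⟨v, hv, by simpa [Γ] using hvw⟩
        · exact ⟨v₀, hv₀, by simpa [Γ] using hf⟩
      have := Finset.card_le_card hsub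
      rw [Finset.card_disjSum, Finset.card_univ, Fintype.card_fin] at this
      have hUM : U.card + M.card = L.card := Finset.card_filter_add_card_filter_not _
      omega
    · push Not at hL
      choose! nx hnx hmin using fun v (hv : ¬ fin v) =>
        (⟨Nat.find (hnext v hv), Nat.find_spec (hnext v hv), fun u hu => Nat.find_min _ hu⟩ :
          ∃ u, (v.1.1 < u ∧ P u v.1.2) ∧ ∀ u' < u, ¬ (v.1.1 < u' ∧ P u' v.1.2))
      let S : V → V ⊕ Fin k := fun v =>
        if h : P (nx v) v.1.2 then Sum.inl ⟨(nx v, v.1.2), h⟩ else Sum.inl v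
      have hS : ∀ v (hv : ¬ fin v), S v = Sum.inl ⟨(nx v, v.1.2), (hnx v hv).2⟩ := by
        intro v hv
        simp [S, (hnx v hv).2]
      refine Finset.card_le_card_of_injOn S ?_ ?_
      · intro v hv
        have hv' := hL v hv
        rw [hS v hv']
        refine Finset.mem_coe.2 (Finset.mem_biUnion.2 ⟨v, hv, ?_⟩)
        simp only [Γ, Finset.mem_filter, Finset.mem_univ, true_and, Sum.elim_inl]
        exact ⟨(hnx v hv').1, hup v hv' _ (hnx v hv').1 (hle _ _ (hnx v hv').2)⟩
      · intro v hv w hw h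
        have hv' := hL v hv
        have hw' := hL w hw
        rw [hS v hv', hS w hw'] at h
        have h := congrArg Subtype.val (Sum.inl_injective h)
        obtain ⟨h1, h2⟩ : nx v = nx w ∧ v.1.2 = w.1.2 := Prod.mk.inj h
        have a1 := hmin v hv' w.1.1 (h1 ▸ (hnx w hw').1)
        have a2 := hmin w hw' v.1.1 (h1 ▸ (hnx v hv').1)
        have b1 : P w.1.1 v.1.2 := h2 ▸ w.2
        have b2 : P v.1.1 w.1.2 := h2 ▸ v.2
        have : v.1.1 = w.1.1 := by
          rcases lt_trichotomy v.1.1 w.1.1 with h | h | h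
          · exact absurd ⟨h, b1⟩ a1
          · exact h
          · exact absurd ⟨h, b2⟩ a2
        exact Subtype.ext (Prod.ext this h2)
  obtain ⟨σ, hσ, hmem⟩ := (Finset.all_card_le_biUnion_card_iff_exists_injective Γ).1 hall
  refine ⟨σ, hσ, fun v w h => ?_, fun v i h => ?_⟩
  · have := hmem v
    rw [h] at this
    simpa [Γ, up] using this
  · have := hmem v
    rw [h] at this
    simpa [Γ, fin] using this

/-- A single trail through all marked positions of a chain. -/
lemma exists_trail_of_chain {k : ℕ}
    {σ : {v : ℕ × Fin n // P v.1 v.2} → {v : ℕ × Fin n // P v.1 v.2} ⊕ Fin k}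
    (hinl : ∀ v w, σ v = Sum.inl w → v.1.1 < w.1.1 ∧
        Linked x mv m v.1.1 v.1.2 w.1.1 (x w.1.1 w.1.2))
    (hle : ∀ u p, P u p → u ≤ m) {i : Fin k} {z : {v : ℕ × Fin n // P v.1 v.2}}
    (hz : σ z = Sum.inr i) {q : Q} (hq : Linked x mv m z.1.1 z.1.2 m q)
    {v : {v : ℕ × Fin n // P v.1 v.2}}
    (hvz : Relation.ReflTransGen (fun v w => σ v = Sum.inl w) v z) :
    ∃ g, IsTrail x mv v.1.1 m g ∧ g v.1.1 = x v.1.1 v.1.2 ∧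
      (∀ w, Relation.ReflTransGen (fun v w => σ v = Sum.inl w) v w →
        g w.1.1 = x w.1.1 w.1.2 ∧ (w.1.1 < m → g (w.1.1 + 1) = x w.1.1 w.1.2)) ∧
      g m = q := by
  induction hvz using Relation.ReflTransGen.head_induction_on with
  | refl =>
    obtain ⟨g, hg, h1, h2, h3⟩ := hq
    refine ⟨g, hg, h1, fun w hw => ?_, h3⟩
    rcases hw.cases_head with rfl | ⟨y, hy, -⟩
    · exact ⟨h1, h2⟩
    · simp [hz] at hy
  | @head v v' hv _ ih =>
    obtain ⟨g₂, hg₂, h2, hc, hm⟩ := ih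
    obtain ⟨hlt, g₁, hg₁, h1, hs, h1'⟩ := hinl v v' hv
    obtain ⟨g, hg, e1, e2⟩ := hg₁.glue hg₂ (h1'.trans h2.symm)
    have hmono : ∀ w, Relation.ReflTransGen (fun v w => σ v = Sum.inl w) v' w →
        v'.1.1 ≤ w.1.1 := by
      intro w hw
      induction hw with
      | refl => exact le_rfl
      | tail _ h ih => exact ih.trans (hinl _ _ h).1.le
    refine ⟨g, hg, (e1 _ hlt.le).trans h1, fun w hw => ?_, (e2 _ (hle _ _ v'.2)).trans hm⟩
    rcases hw.cases_head with rfl | ⟨y, hy, hyw⟩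
    · exact ⟨(e1 _ hlt.le).trans h1, fun h => (e1 _ hlt).trans (hs h)⟩
    · obtain rfl : v' = y := by simpa [hv] using hy
      have := hmono w hyw
      rw [e2 _ this, e2 _ (by omega)]
      exact hc w hyw

/-- If there are more processes than local states, then any number `k` of processes that is at
least the number of local states can cover all positions of the processes at rest, and finish
in final states of the run without doubling any that is occupied only once. -/
lemma exists_covering_trails [Fintype Q] {k : ℕ} (hk : Fintype.card Q ≤ k)
    (hn : Fintype.card Q < n) {q₀ : Q} (h0 : ∀ p, x 0 p = q₀)
    (hmv : ∀ t < m, ∀ p, mv t ≠ some p → x (t + 1) p = x t p) :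
    ∃ f : Fin k → ℕ → Q, (∀ i, f i 0 = q₀) ∧ (∀ i, IsTrail x mv 0 m (f i)) ∧
      (∀ t < m, ∀ p, mv t ≠ some p → ∃ i, f i t = x t p ∧ f i (t + 1) = x t p) ∧
      (∀ i, ∃ p, f i m = x m p) ∧
      (∀ i j, i ≠ j → f i m = f j m → ∃ r r', r' ≠ r ∧ x m r = f i m ∧ x m r' = f i m) := by
  classical
  have : Nonempty (Fin n) := ⟨⟨0, by omega⟩⟩
  let rep : ℕ → Q → Fin n := fun t q => Classical.epsilon fun p => mv t ≠ some p ∧ x t p = q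
  have hrep : ∀ t p, mv t ≠ some p →
      mv t ≠ some (rep t (x t p)) ∧ x t (rep t (x t p)) = x t p := fun t p h =>
    Classical.epsilon_spec (p := fun p' => mv t ≠ some p' ∧ x t p' = x t p) ⟨p, h, rfl⟩
  let P : ℕ → Fin n → Prop := fun t p => (t < m ∧ mv t ≠ some p ∧ rep t (x t p) = p) ∨
    (t = m ∧ ∀ p', x m p' = x m p → p' = p)
  have hle : ∀ u p, P u p → u ≤ m := by
    rintro u p (h | h) <;> omega
  have hinj : ∀ u p p', P u p → P u p' → x u p = x u p' → p = p' := by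
    rintro u p p' (⟨h, -, h1⟩ | ⟨rfl, h1⟩) (⟨h', -, h2⟩ | ⟨h', h2⟩) he
    · rw [← h1, he, h2]
    · omega
    · omega
    · exact h2 p he
  have hlast : ∀ p, P m p ↔ ∀ p', x m p' = x m p → p' = p := by
    intro p; simp [P]
  obtain ⟨σ, hσ, hinl, hinr⟩ := exists_chain_map (P := P) hk hmv hle hinj
    (by rintro u p (⟨h, h1, -⟩ | h) hu
        · exact hmv u hu p h1
        · omega) hlast
  let R := fun v w => σ v = Sum.inl w
  have hend : ∀ d v, m - v.1.1 ≤ d → ∃ z i, Relation.ReflTransGen R v z ∧ σ z = Sum.inr i := by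
    intro d
    induction d with
    | zero =>
      intro v hd
      rcases h : σ v with w | i
      · have := (hinl v w h).1
        have := hle _ _ w.2
        omega
      · exact ⟨v, i, .refl, h⟩
    | succ d ih =>
      intro v hd
      rcases h : σ v with w | i
      · have := (hinl v w h).1
        obtain ⟨z, i, hz, hi⟩ := ih w (by omega)
        exact ⟨z, i, .head h hz, hi⟩
      · exact ⟨v, i, .refl, h⟩
  obtain ⟨r₀, r₁, hne, hr⟩ := Fintype.exists_ne_map_eq_of_card_lt (x m) (by simpa using hn)
  have htrail : ∀ i, ∃ g, g 0 = q₀ ∧ IsTrail x mv 0 m g ∧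
      (∀ v z, Relation.ReflTransGen R v z → σ z = Sum.inr i →
        g v.1.1 = x v.1.1 v.1.2 ∧ (v.1.1 < m → g (v.1.1 + 1) = x v.1.1 v.1.2)) ∧
      ∃ p, g m = x m p ∧ ((∃ z, σ z = Sum.inr i ∧ z.1 = (m, p)) ∨ ∃ r, r ≠ p ∧ x m r = x m p) := by
    intro i
    by_cases hi : ∃ z, σ z = Sum.inr i
    · obtain ⟨z, hz⟩ := hi
      obtain ⟨r, hr, hr'⟩ := hinr z i hz
      have hex : ∃ u, ∃ v, Relation.ReflTransGen R v z ∧ v.1.1 = u := ⟨_, z, .refl, rfl⟩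
      obtain ⟨v, hvz, hvu⟩ := Nat.find_spec hex
      have hmin : ∀ w, Relation.ReflTransGen R w z → v.1.1 ≤ w.1.1 := fun w hw =>
        hvu ▸ Nat.find_min' hex ⟨w, hw, rfl⟩
      obtain ⟨g₂, hg₂, h2, hc, hm⟩ := exists_trail_of_chain hinl hle hz hr hvz
      obtain ⟨g, hg, e1, e2⟩ :=
        (isTrail_process hmv 0 (hle _ _ v.2) v.1.2).glue hg₂ h2.symm
      refine ⟨g, (e1 0 (Nat.zero_le _)).trans (h0 _), hg, fun w z' hw hz' => ?_, ?_⟩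
      · obtain rfl : z' = z := hσ (hz'.trans hz.symm)
        have hu : Relator.RightUnique (Function.swap R) := fun a b c hb hc =>
          hσ (Eq.trans hb (Eq.symm hc))
        have hvw : Relation.ReflTransGen R v w := by
          rcases Relation.ReflTransGen.total_of_right_unique hu
            (Relation.reflTransGen_swap.2 hvz) (Relation.reflTransGen_swap.2 hw) with h | h
          · rw [Relation.reflTransGen_swap] at h
            rcases h.cases_tail with rfl | ⟨y, hy, hyv⟩
            · exact .refl
            · have hlt := (hinl y v hyv).1
              have := hmin y (.head hyv hvz)
              omega
          · exact Relation.reflTransGen_swap.1 h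
        rw [e2 _ (hmin w hw), e2 _ ((hmin w hw).trans (Nat.le_succ _))]
        exact hc w hvw
      · have hgm : g m = x m r := (e2 _ (hle _ _ v.2)).trans hm
        rcases hr' with h | h
        · obtain ⟨⟨u, p⟩, hp⟩ := z
          obtain rfl : u = m := h
          obtain ⟨g', -, h1, -, h2⟩ := hr
          exact ⟨p, hgm.trans (h2.symm.trans h1), Or.inl ⟨_, hz, rfl⟩⟩
        · exact ⟨r, hgm, Or.inr h⟩
    · exact ⟨fun t => x t r₀, h0 _, isTrail_process hmv 0 le_rfl _,
        fun v z _ hz => absurd ⟨z, hz⟩ hi, r₀, rfl, Or.inr ⟨r₁, hne.symm, hr.symm⟩⟩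
  choose f hf0 hft hfc hfm using htrail
  refine ⟨f, hf0, hft, fun t ht p hp => ?_, fun i => ?_, fun i j hij hfij => ?_⟩
  · obtain ⟨h1, h2⟩ := hrep t p hp
    let v : {v : ℕ × Fin n // P v.1 v.2} :=
      ⟨(t, rep t (x t p)), Or.inl ⟨ht, h1, by simp only [h2]⟩⟩
    obtain ⟨z, i, hvz, hz⟩ := hend _ v le_rfl
    obtain ⟨a1, a2⟩ := hfc i v z hvz hz
    exact ⟨i, a1.trans h2, (a2 ht).trans h2⟩
  · obtain ⟨p, hp, -⟩ := hfm i
    exact ⟨p, hp⟩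
  · obtain ⟨p, hp, h1⟩ := hfm i
    obtain ⟨p', hp', h2⟩ := hfm j
    rcases h1 with ⟨z, hz, h1⟩ | ⟨r, hr, hr'⟩
    · rcases h2 with ⟨z', hz', h2⟩ | ⟨r, hr, hr'⟩
      · exfalso
        have hP : P m p' := by have := z'.2; rwa [h2] at this
        have hpp : p = p' := (hlast p').1 hP p (by rw [← hp, ← hp', hfij])
        have : z = z' := Subtype.ext (by rw [h1, h2, hpp])
        subst this
        exact hij (Sum.inr_injective (hz.symm.trans hz'))
      · exact ⟨p', r, hr, by rw [hfij, hp'], by rw [hfij, hp', hr']⟩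
    · exact ⟨p, r, hr, hp.symm, by rw [hp, hr']⟩

end Trails

section Simulation

variable {QA QB SA SB : Type} {A : Template QA SA (Set (QA ⊕ QB))}
  {B : Template QB SB (Set (QA ⊕ QB))}

/-- One step of a run, on pairs of a global state and a global input. -/
def Move (A : Template QA SA (Set (QA ⊕ QB))) (B : Template QB SB (Set (QA ⊕ QB))) {n : ℕ}
    (c c' : GState QA QB n × GInput SA SB n) : Prop :=
  ∃ p, step A B disjSat c.1 c.2 p c'.1 ∧ ∀ p', p' ≠ p → inp c'.2 p' = inp c.2 p'

lemma exists_seq_of_reflTransGen {α : Type*} {r : α → α → Prop} {a b : α}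
    (h : Relation.ReflTransGen r a b) :
    ∃ (m : ℕ) (g : ℕ → α), g 0 = a ∧ g m = b ∧ ∀ t < m, r (g t) (g (t + 1)) := by
  induction h using Relation.ReflTransGen.head_induction_on with
  | refl => exact ⟨0, fun _ => b, rfl, rfl, by simp⟩
  | @head a c hac _ ih =>
    obtain ⟨m, g, h0, hm, hg⟩ := ih
    refine ⟨m + 1, fun t => Nat.casesOn t a g, rfl, hm, fun t ht => ?_⟩
    cases t with
    | zero => simpa [h0] using hac
    | succ t => exact hg t (by omega)

lemma hasGlobalDeadlock_of_reach {n : ℕ} {c c' : GState QA QB n × GInput SA SB n}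
    (hc : isInit A B c.1) (h : Relation.ReflTransGen (Move A B) c c')
    (hd : ∀ p, ¬ enabled A B disjSat c'.1 c'.2 p) : hasGlobalDeadlock A B disjSat n := by
  obtain ⟨m, g, h0, hm, hg⟩ := exists_seq_of_reflTransGen h
  choose! mv h1 h2 using hg
  exact ⟨m, fun t => (g t).1, fun t => (g t).2, mv, by simpa [h0] using hc, h1, h2,
    by simpa [hm] using hd⟩

/-- Several `B`-processes in the same state can take the same transition one after another if
its guard is witnessed by a process that does not take it. -/
lemma reach_of_same_transition {k : ℕ} {a : QA} {ea : SA} {y y' : Fin k → QB}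
    {E E' : Fin k → SB} (J : Finset (Fin k)) {q q' : QB} {σ : SB} {g : Set (QA ⊕ QB)}
    (htr : (q, σ, g, q') ∈ B.trans) (hy : ∀ i ∈ J, y i = q ∧ E i = σ ∧ y' i = q')
    (hJ : ∀ i ∉ J, y' i = y i ∧ E' i = E i)
    (hw : Sum.inl a ∈ g ∨ ∃ j ∉ J, Sum.inr (y j) ∈ g) :
    Relation.ReflTransGen (Move A B) ((a, y), (ea, E)) ((a, y'), (ea, E')) := by
  classical
  have key : ∀ I : Finset (Fin k), I ⊆ J → Relation.ReflTransGen (Move A B)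
      ((a, y), (ea, E)) ((a, I.piecewise y' y), (ea, I.piecewise E' E)) := by
    intro I
    induction I using Finset.induction_on with
    | empty => intro _; simpa using Relation.ReflTransGen.refl
    | insert i I hi ih =>
      intro hI
      obtain ⟨hiJ, hIJ⟩ := Finset.insert_subset_iff.1 hI
      obtain ⟨h1, h2, h3⟩ := hy i hiJ
      refine (ih hIJ).tail ⟨some i, ⟨g, q', ?_, ?_, ?_⟩, ?_⟩
      · simpa [hi, h1, h2] using htr
      · rcases hw with h | ⟨j, hj, h⟩
        · exact ⟨_, ⟨none, by simp, rfl⟩, h⟩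
        · refine ⟨_, ⟨some j, ?_, rfl⟩, ?_⟩
          · rintro ⟨⟩
            exact hj hiJ
          · have : j ∉ I := fun h' => hj (hIJ h')
            simpa [view, this] using h
      · rw [Finset.piecewise_insert, h3]
      · rintro (_ | j) hj
        · rfl
        · have : j ≠ i := fun h => hj (by rw [h])
          simp [inp, this]
  have h1 : J.piecewise y' y = y' := by
    ext i; by_cases h : i ∈ J <;> simp [h, hJ]
  have h2 : J.piecewise E' E = E' := by
    ext i; by_cases h : i ∈ J <;> simp [h, hJ]
  simpa [h1, h2] using key J subset_rfl

/-- Trails that cover the positions of all processes at rest, and whose final states are final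
states of a deadlocked run that are not wrongly doubled, yield a deadlocked run. -/
lemma hasGlobalDeadlock_of_trails {n k m : ℕ} {s : ℕ → GState QA QB n}
    {e : ℕ → GInput SA SB n} {mv : ℕ → Proc n} (hinit : isInit A B (s 0))
    (hstep : ∀ t < m, step A B disjSat (s t) (e t) (mv t) (s (t + 1)))
    (hpers : ∀ t < m, ∀ p, p ≠ mv t → inp (e (t + 1)) p = inp (e t) p)
    (hdead : ∀ p, ¬ enabled A B disjSat (s m) (e m) p)
    {f : Fin k → ℕ → QB} (hf0 : ∀ i, f i 0 = B.init)
    (hft : ∀ i, IsTrail (fun t => (s t).2) mv 0 m (f i))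
    (hfc : ∀ t < m, ∀ p, mv t ≠ some p → ∃ i, f i t = (s t).2 p ∧ f i (t + 1) = (s t).2 p)
    (hfm : ∀ i, ∃ p, f i m = (s m).2 p)
    (hdbl : ∀ i j, i ≠ j → f i m = f j m → Sum.inr (f i m) ∉ EnableSet B (f i m) ∨
      ∃ r r', r' ≠ r ∧ (s m).2 r = f i m ∧ (s m).2 r' = f i m) :
    hasGlobalDeadlock A B disjSat k := by
  classical
  choose ρ hρ using hfm
  have hreach : ∀ d ≤ m, ∃ E : Fin k → SB, Relation.ReflTransGen (Move A B)
      (((s (m - d)).1, fun i => f i (m - d)), ((e (m - d)).1, E))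
      (((s m).1, fun i => f i m), ((e m).1, fun i => (e m).2 (ρ i))) := by
    intro d
    induction d with
    | zero => exact fun _ => ⟨_, .refl⟩
    | succ d ih =>
      intro hd
      obtain ⟨E', hE'⟩ := ih (by omega)
      obtain ⟨t, ht⟩ : ∃ t, t = m - (d + 1) := ⟨_, rfl⟩
      have htm : t < m := by omega
      rw [← ht]
      rw [show m - d = t + 1 by omega] at hE'
      have hs := hstep t htm
      rcases hmv : mv t with _ | p
      · rw [hmv] at hs
        obtain ⟨g, q', htr, ⟨_, ⟨p', hp', rfl⟩, hg⟩, hs'⟩ := hs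
        have hstay : ∀ i, f i (t + 1) = f i t := fun i => by
          rcases hft i t (Nat.zero_le _) htm with h | ⟨p, hp, -⟩
          · exact h
          · simp [hmv] at hp
        refine ⟨E', .head ⟨none, ⟨g, q', htr, ?_, ?_⟩, ?_⟩ hE'⟩
        · rcases p' with _ | p'
          · exact absurd rfl hp'
          · obtain ⟨i, hi, -⟩ := hfc t htm p' (by simp [hmv])
            exact ⟨_, ⟨some i, by simp, rfl⟩, by simpa [view, hi] using hg⟩
        · simp [hs', hstay]
        · rintro (_ | j) hj
          · exact absurd rfl hj
          · rfl
      · rw [hmv] at hs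
        obtain ⟨g, q', htr, ⟨_, ⟨p', hp', rfl⟩, hg⟩, hs'⟩ := hs
        have hA : (s (t + 1)).1 = (s t).1 := by rw [hs']
        have hp1 : (s (t + 1)).2 p = q' := by simp [hs']
        have he : (e (t + 1)).1 = (e t).1 := by
          simpa [inp] using hpers t htm none (by simp [hmv])
        rw [hA, he] at hE'
        refine ⟨fun i => if f i (t + 1) = f i t then E' i else (e t).2 p,
          Relation.ReflTransGen.trans
            (reach_of_same_transition (Finset.univ.filter fun i => f i (t + 1) ≠ f i t)
              htr ?_ ?_ ?_) hE'⟩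
        · intro i hi
          have hi : f i (t + 1) ≠ f i t := by simpa using hi
          rcases hft i t (Nat.zero_le _) htm with h | ⟨p'', hp'', h1, h2⟩
          · exact absurd h hi
          · obtain rfl : p = p'' := by simpa [hmv] using hp''
            exact ⟨h1, by simp [hi], h2.trans hp1⟩
        · intro i hi
          have hi : f i (t + 1) = f i t := by simpa using hi
          simp [hi]
        · rcases p' with _ | p'
          · exact Or.inl hg
          · obtain ⟨i, hi, hi'⟩ := hfc t htm p' (by rw [hmv]; exact fun h => hp' h.symm)
            exact Or.inr ⟨i, by simp [hi, hi'], by simpa [view, hi] using hg⟩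
  obtain ⟨E, hE⟩ := hreach m le_rfl
  rw [Nat.sub_self] at hE
  refine hasGlobalDeadlock_of_reach ⟨hinit.1, hf0⟩ hE ?_
  rintro (_ | i) ⟨g, q', htr, ⟨_, ⟨p', hp', rfl⟩, hg⟩⟩
  · refine hdead none ⟨g, q', htr, ?_⟩
    rcases p' with _ | j
    · exact absurd rfl hp'
    · exact ⟨_, ⟨some (ρ j), by simp, rfl⟩, by simpa [view, hρ] using hg⟩
  · have htr' : ((s m).2 (ρ i), (e m).2 (ρ i), g, q') ∈ B.trans := by
      simpa [hρ] using htr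
    refine hdead (some (ρ i)) ⟨g, q', htr', ?_⟩
    rcases p' with _ | j
    · exact ⟨_, ⟨none, by simp, rfl⟩, hg⟩
    · have hg : Sum.inr (f j m) ∈ g := hg
      have hij : i ≠ j := fun h => hp' (by rw [h])
      suffices ∃ r, r ≠ ρ i ∧ (s m).2 r = f j m by
        obtain ⟨r, hr, hr'⟩ := this
        exact ⟨_, ⟨some r, by simpa using hr, rfl⟩, by simpa [view, hr'] using hg⟩
      by_cases hfij : f i m = f j m
      · rcases hdbl i j hij hfij with h | ⟨r, r', hne, h1, h2⟩
        · exact absurd ⟨_, g, q', htr, by rw [hfij]; exact hg⟩ h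
        · by_cases hr : r = ρ i
          · exact ⟨r', hr ▸ hne, h2.trans hfij⟩
          · exact ⟨r, hr, h1.trans hfij⟩
      · exact ⟨ρ j, fun h => hfij (by rw [hρ i, hρ j, h]), (hρ j).symm⟩

lemma step_snd_of_ne {n : ℕ} {s s' : GState QA QB n} {e : GInput SA SB n} {p : Proc n}
    (h : step A B disjSat s e p s') {i : Fin n} (hi : p ≠ some i) : s'.2 i = s.2 i := by
  rcases p with _ | j
  · obtain ⟨g, q', -, -, rfl⟩ := h
    rfl
  · obtain ⟨g, q', -, -, rfl⟩ := h
    have : i ≠ j := fun h => hi (by rw [h])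
    simp [this]

/-- A global deadlock with more `B`-processes than local states yields one for any number of
`B`-processes not below the number of local states. -/
lemma hasGlobalDeadlock_of_card_lt [Fintype QB] {n k : ℕ} (hn : Fintype.card QB < n)
    (hk : Fintype.card QB ≤ k) (h : hasGlobalDeadlock A B disjSat n) :
    hasGlobalDeadlock A B disjSat k := by
  obtain ⟨m, s, e, mv, hinit, hstep, hpers, hdead⟩ := h
  obtain ⟨f, hf0, hft, hfc, hfm, hdbl⟩ := exists_covering_trails (x := fun t => (s t).2)
    (mv := mv) (m := m) hk hn hinit.2 (fun t ht p hp => step_snd_of_ne (hstep t ht) hp)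
  exact hasGlobalDeadlock_of_trails hinit hstep hpers hdead hf0 hft hfc hfm
    fun i j hij h => Or.inr (hdbl i j hij h)

/-- If no state enables itself, then a global deadlock persists when processes are added. -/
lemma hasGlobalDeadlock_mono_of_not_selfEnabling {n k : ℕ}
    (hB : ∀ q, Sum.inr q ∉ EnableSet B q) (hn : 0 < n) (hnk : n ≤ k)
    (h : hasGlobalDeadlock A B disjSat n) : hasGlobalDeadlock A B disjSat k := by
  obtain ⟨m, s, e, mv, hinit, hstep, hpers, hdead⟩ := h
  let c : Fin k → Fin n := fun i => if h : i.1 < n then ⟨i, h⟩ else ⟨0, hn⟩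
  refine hasGlobalDeadlock_of_trails (f := fun i t => (s t).2 (c i)) hinit hstep hpers hdead
    (fun i => hinit.2 _)
    (fun i => isTrail_process (fun t ht p hp => step_snd_of_ne (hstep t ht) hp) 0 le_rfl _)
    (fun t ht p hp => ?_) (fun i => ⟨_, rfl⟩) (fun i j _ _ => Or.inl (hB _))
  have hc : c ⟨p, p.2.trans_le hnk⟩ = p := by simp [c]
  refine ⟨⟨p, p.2.trans_le hnk⟩, ?_, ?_⟩
  · simp only [hc]
  · simp only [hc]
    exact step_snd_of_ne (hstep t ht) hp

end Simulation

/-- **Disjunctive Cutoff Theorem (global deadlock detection).**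
`|B| + |N*|` is a cutoff for global deadlock detection in disjunctive systems, where
`N = {q ∈ Q_B : q ∈ Enable_q}` and `N*` is a maximum-cardinality subset of `N` whose
distinct members are pairwise not in each other's `Enable` sets. -/
theorem disjunctive_global_deadlock_cutoff
    (QA QB SA SB : Type) [Fintype QA] [Fintype QB] [Fintype SA] [Fintype SB]
    (A : Template QA SA (Set (QA ⊕ QB))) (B : Template QB SB (Set (QA ⊕ QB)))
    (Nstar : Set QB)
    (hsub : ∀ q ∈ Nstar, Sum.inr q ∈ EnableSet B q)
    (hind : ∀ qi ∈ Nstar, ∀ qj ∈ Nstar, qi ≠ qj →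
      Sum.inr qi ∉ EnableSet B qj ∧ Sum.inr qj ∉ EnableSet B qi)
    (hmax : ∀ S : Set QB, (∀ q ∈ S, Sum.inr q ∈ EnableSet B q) →
      (∀ qi ∈ S, ∀ qj ∈ S, qi ≠ qj →
        Sum.inr qi ∉ EnableSet B qj ∧ Sum.inr qj ∉ EnableSet B qi) →
      S.ncard ≤ Nstar.ncard) :
    ∀ n, Fintype.card QB + Nstar.ncard ≤ n →
      (hasGlobalDeadlock A B disjSat n ↔
       hasGlobalDeadlock A B disjSat (Fintype.card QB + Nstar.ncard)) := by
  intro n hn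
  rcases Nat.eq_zero_or_pos Nstar.ncard with h0 | hpos
  · have hB : ∀ q, Sum.inr q ∉ EnableSet B q := by
      intro q hq
      have := hmax {q} (by rintro _ rfl; exact hq)
        (by rintro _ rfl _ rfl h; exact absurd rfl h)
      rw [Set.ncard_singleton] at this
      omega
    have hc : 0 < Fintype.card QB := Fintype.card_pos_iff.2 ⟨B.init⟩
    rcases hn.eq_or_lt with rfl | hlt
    · rfl
    · exact ⟨hasGlobalDeadlock_of_card_lt (by omega) (by omega),
        hasGlobalDeadlock_mono_of_not_selfEnabling hB (by omega) hn⟩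
  · exact ⟨hasGlobalDeadlock_of_card_lt (by omega) (by omega),
      hasGlobalDeadlock_of_card_lt (by omega) (by omega)⟩
end GP
end
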